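/- The eight 4×4 matrices obtained by redefining the first pair as λ_1 = −î(γ̂_1 + σ̂_1)/2 and λ_2 = −î(γ̂_2 + σ̂_2)/2, keeping λ_4 = (j σ̂_1 + γ̂_2)/2 and λ_5 = (j σ̂_2 − γ̂_1)/2, and applying the recursion λ_3 = −λ_1 λ_2, λ_6 = λ_1 λ_5 − λ_5 λ_1, λ_7 = λ_5 λ_2 − λ_2 λ_5, λ_8 = (−2 λ_4 λ_5 − λ_3)/√3, satisfy the su(3) commutation relations λ_a λ_b − λ_b λ_a = −2 Σ_{c=1}^{8} f_{abc} λ_c for all a, b ∈ {1,…,8}. -/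

import Mathlib

open Matrix Complex

noncomputable section

/-- The Dirac–Pauli gamma matrices. -/
def γ : Fin 4 → Matrix (Fin 4) (Fin 4) ℂ :=
  ![!![1, 0, 0, 0; 0, 1, 0, 0; 0, 0, -1, 0; 0, 0, 0, -1],
    !![0, 0, 0, -1; 0, 0, -1, 0; 0, 1, 0, 0; 1, 0, 0, 0],
    !![0, 0, 0, I; 0, 0, -I, 0; 0, -I, 0, 0; I, 0, 0, 0],
    !![0, 0, -1, 0; 0, 0, 0, 1; 1, 0, 0, 0; 0, -1, 0, 0]]

/-- The 4×4 relative-space matrices σ̂_μ (with σ̂_0 = γ̂_0 and σ̂_k = γ̂_k γ̂_0). -/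
def σ4 : Fin 4 → Matrix (Fin 4) (Fin 4) ℂ := fun μ => γ μ * γ 0

/-- The pseudoscalar î := γ̂_0 γ̂_1 γ̂_2 γ̂_3. -/
def ii : Matrix (Fin 4) (Fin 4) ℂ := γ 0 * γ 1 * γ 2 * γ 3

/-- Auxiliary lookup: nonzero values of the su(3) structure constants on a chosen
set of base triples (indices `0,…,7` correspond to `1,…,8`):
`f_{123} = 1`, `f_{147} = f_{246} = f_{257} = f_{345} = f_{516} = f_{637} = 1/2`,
`f_{458} = f_{678} = √3/2`. -/
def fAux : Fin 8 → Fin 8 → Fin 8 → ℝ := fun a b c =>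
  if a = 0 ∧ b = 1 ∧ c = 2 then 1
  else if a = 0 ∧ b = 3 ∧ c = 6 then 1/2
  else if a = 1 ∧ b = 3 ∧ c = 5 then 1/2
  else if a = 1 ∧ b = 4 ∧ c = 6 then 1/2
  else if a = 2 ∧ b = 3 ∧ c = 4 then 1/2
  else if a = 4 ∧ b = 0 ∧ c = 5 then 1/2
  else if a = 5 ∧ b = 2 ∧ c = 6 then 1/2
  else if a = 3 ∧ b = 4 ∧ c = 7 then Real.sqrt 3 / 2
  else if a = 5 ∧ b = 6 ∧ c = 7 then Real.sqrt 3 / 2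
  else 0

/-- The su(3) structure constants `f_{abc}`: totally antisymmetric in the indices,
generated by the nonvanishing base values recorded in `fAux`. -/
def f (a b c : Fin 8) : ℝ :=
  fAux a b c - fAux a c b + fAux b c a - fAux b a c + fAux c a b - fAux c b a

def l1 : Matrix (Fin 4) (Fin 4) ℂ := -((2 : ℂ)⁻¹ • (ii * (γ 1 + σ4 1)))
def l2 : Matrix (Fin 4) (Fin 4) ℂ := -((2 : ℂ)⁻¹ • (ii * (γ 2 + σ4 2)))
def l4 : Matrix (Fin 4) (Fin 4) ℂ := (2 : ℂ)⁻¹ • (I • σ4 1 + γ 2)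
def l5 : Matrix (Fin 4) (Fin 4) ℂ := (2 : ℂ)⁻¹ • (I • σ4 2 - γ 1)
def l3 : Matrix (Fin 4) (Fin 4) ℂ := -(l1 * l2)
def l6 : Matrix (Fin 4) (Fin 4) ℂ := l1 * l5 - l5 * l1
def l7 : Matrix (Fin 4) (Fin 4) ℂ := l5 * l2 - l2 * l5
def l8 : Matrix (Fin 4) (Fin 4) ℂ :=
  (Real.sqrt 3 : ℂ)⁻¹ • ((-2 : ℂ) • (l4 * l5) - l3)

/-- The λ-multivector representatives, indexed by `Fin 8`
(index `a` corresponding to λ_{a+1}). -/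
def lam : Fin 8 → Matrix (Fin 4) (Fin 4) ℂ := ![l1, l2, l3, l4, l5, l6, l7, l8]

theorem ii_eq : ii = !![0, 0, I, 0; 0, 0, 0, I; I, 0, 0, 0; 0, I, 0, 0] := by
  simp [ii, γ]

theorem l1_eq : l1 = !![0, -I, 0, 0; -I, 0, 0, 0; 0, 0, 0, 0; 0, 0, 0, 0] := by
  ext i j
  fin_cases i <;> fin_cases j <;> simp [l1, ii_eq, γ, σ4] <;> ring

theorem l2_eq : l2 = !![0, -1, 0, 0; 1, 0, 0, 0; 0, 0, 0, 0; 0, 0, 0, 0] := by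
  ext i j
  fin_cases i <;> fin_cases j <;> simp [l2, ii_eq, γ, σ4] <;> ring_nf <;> simp

theorem l4_eq : l4 = !![0, 0, 0, I; 0, 0, 0, 0; 0, 0, 0, 0; I, 0, 0, 0] := by
  ext i j
  fin_cases i <;> fin_cases j <;> simp [l4, γ, σ4] <;> ring

theorem l5_eq : l5 = !![0, 0, 0, 1; 0, 0, 0, 0; 0, 0, 0, 0; -1, 0, 0, 0] := by
  ext i j
  fin_cases i <;> fin_cases j <;> simp [l5, γ, σ4] <;> ring

theorem l3_eq : l3 = !![I, 0, 0, 0; 0, -I, 0, 0; 0, 0, 0, 0; 0, 0, 0, 0] := by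
  ext i j
  fin_cases i <;> fin_cases j <;> simp [l3, l1_eq, l2_eq]

theorem l6_eq : l6 = !![0, 0, 0, 0; 0, 0, 0, -I; 0, 0, 0, 0; 0, -I, 0, 0] := by
  ext i j
  fin_cases i <;> fin_cases j <;> simp [l6, l1_eq, l5_eq]

theorem l7_eq : l7 = !![0, 0, 0, 0; 0, 0, 0, -1; 0, 0, 0, 0; 0, 1, 0, 0] := by
  ext i j
  fin_cases i <;> fin_cases j <;> simp [l7, l5_eq, l2_eq]

theorem l8_eq : l8 =
    ((Real.sqrt 3 : ℂ)⁻¹ * I) • !![1, 0, 0, 0; 0, 1, 0, 0; 0, 0, 0, 0; 0, 0, 0, -2] := by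
  ext i j
  fin_cases i <;> fin_cases j <;> simp [l8, l3_eq, l4_eq, l5_eq] <;> ring

theorem f_swap (a b c : Fin 8) : f b a c = -f a b c := by
  unfold f; ring

theorem lam_bracket_swap {a b : Fin 8}
    (h : lam a * lam b - lam b * lam a = (-2 : ℝ) • ∑ c : Fin 8, f a b c • lam c) :
    lam b * lam a - lam a * lam b = (-2 : ℝ) • ∑ c : Fin 8, f b a c • lam c := by
  rw [← neg_sub, h]
  simp only [f_swap a b, neg_smul, Finset.sum_neg_distrib, smul_neg]

set_option maxHeartbeats 1000000 in
theorem lam_bracket_of_lt {a b : Fin 8} (hab : a < b) :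
    lam a * lam b - lam b * lam a = (-2 : ℝ) • ∑ c : Fin 8, f a b c • lam c := by
  have h3 : (Real.sqrt 3 : ℂ) ≠ 0 := by simp
  have h3_sq : (Real.sqrt 3 : ℂ) ^ 2 = 3 := by
    rw [← ofReal_pow, Real.sq_sqrt (by norm_num)]; norm_num
  fin_cases a <;> fin_cases b <;> first | exact absurd hab (by decide) | skip
  all_goals
    simp [f, fAux, Fin.sum_univ_eight, lam, l1_eq, l2_eq, l3_eq, l4_eq, l5_eq, l6_eq, l7_eq, l8_eq]
  all_goals
    simp [← Matrix.ext_iff, funext_iff, Fin.forall_fin_succ]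
  all_goals and_intros
  all_goals
    field_simp
    ring_nf
    try simp [I_sq, h3_sq]

theorem gauge_copy_1_from_csta_commutation_relations :
    ∀ a b : Fin 8,
      lam a * lam b - lam b * lam a =
        (-2 : ℝ) • ∑ c : Fin 8, f a b c • lam c := by
  intro a b
  rcases lt_trichotomy a b with h | rfl | h
  · exact lam_bracket_of_lt h
  · have hf : ∀ c, f a a c = 0 := fun c => by unfold f; ring
    simp [hf]
  · exact lam_bracket_swap (lam_bracket_of_lt h)

end
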